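/- Set γ = ω_2·diag(ϖ, I_{N-1}). For every ω ∈ W_0 and a ∈ S_ω, the vector a^γ := (1+a_2−a_1, 1+a_3−a_1, …, 1+a_{N-1}−a_1, 1−a_1) lies in S_{ω ω_2^{-1}} and γ·f_{ω,a} = f_{ω ω_2^{-1}, a^γ}. -/

import Mathlib

open Matrix

noncomputable section

namespace IH

variable (p : ℕ) [Fact p.Prime]

/-- `\bar{𝔽}_p`, an algebraic closure of the residue field. -/
abbrev kb := AlgebraicClosure (ZMod p)

variable (N : ℕ)

/-- `G = GL_N(F)` with `F = ℚ_p`. -/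
abbrev GG := GL (Fin N) ℚ_[p]
/-- `GL_N(O_F)` (as an abstract group, mapping onto `K ⊆ G`). -/
abbrev MM := GL (Fin N) ℤ_[p]
/-- `GL_N(k_F)`. -/
abbrev Gk := GL (Fin N) (ZMod p)

/-- The inclusion `GL_N(O_F) → GL_N(F)`. -/
def iotaM : MM p N →* GG p N := Matrix.GeneralLinearGroup.map (PadicInt.Coe.ringHom)

/-- The reduction map `red : GL_N(O_F) → GL_N(k_F)`. -/
def redM : MM p N →* Gk p N := Matrix.GeneralLinearGroup.map (PadicInt.toZMod)

/-- Elements of `GL_N(O_F)` whose reduction is upper triangular: the Iwahori condition. -/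
def Ipre : Set (MM p N) :=
  {m | ∀ i j : Fin N, j < i → ((redM p N m : Matrix (Fin N) (Fin N) (ZMod p)) i j = 0)}

/-- Elements of `GL_N(O_F)` whose reduction is upper triangular unipotent: pro-p Iwahori. -/
def I1pre : Set (MM p N) :=
  {m | m ∈ Ipre p N ∧ ∀ i : Fin N, ((redM p N m : Matrix (Fin N) (Fin N) (ZMod p)) i i = 1)}

/-- Elements of `GL_N(O_F)` reducing to the identity: `K_1 = ker red`. -/
def K1pre : Set (MM p N) := {m | redM p N m = 1}

/-- `K = GL_N(O_F)` as a subset of `G`. -/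
def Kset : Set (GG p N) := Set.range (iotaM p N)
/-- The Iwahori subgroup `I ⊆ G`. -/
def Iset : Set (GG p N) := iotaM p N '' Ipre p N
/-- The pro-p Iwahori subgroup `I_1 ⊆ G`. -/
def I1set : Set (GG p N) := iotaM p N '' I1pre p N
/-- `K_1 ⊆ G`. -/
def K1set : Set (GG p N) := iotaM p N '' K1pre p N

/-- The uniformizer `ϖ = p` as a unit of `ℚ_p`. -/
def pU : ℚ_[p]ˣ :=
  Units.mk0 (p : ℚ_[p]) (by
    have h := (Fact.out : p.Prime).ne_zero
    exact_mod_cast Nat.cast_ne_zero.mpr h)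

/-- Scalar matrices as elements of `G`. -/
def scalarGL (u : ℚ_[p]ˣ) : GG p N :=
  Units.map (algebraMap ℚ_[p] (Matrix (Fin N) (Fin N) ℚ_[p])).toMonoidHom u

/-- The central element `ϖ^n · Id`. -/
def piSc (n : ℤ) : GG p N := scalarGL p N (pU p ^ n)

/-- Invertible diagonal matrices. -/
def diagGL (d : Fin N → ℚ_[p]ˣ) : GG p N where
  val := Matrix.diagonal fun i => (d i : ℚ_[p])
  inv := Matrix.diagonal fun i => (((d i)⁻¹ : ℚ_[p]ˣ) : ℚ_[p])
  val_inv := by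
    rw [Matrix.diagonal_mul_diagonal]
    simp
  inv_val := by
    rw [Matrix.diagonal_mul_diagonal]
    simp

/-- extend `a ∈ ℤ^{N-1}` by `0` in the last coordinate. -/
def expo (a : Fin (N - 1) → ℤ) : Fin N → ℤ :=
  fun i => if h : (i : ℕ) < N - 1 then a ⟨i, h⟩ else 0

/-- `t_a = diag(ϖ^{a_1}, …, ϖ^{a_{N-1}}, 1)`. -/
def tGL (a : Fin (N - 1) → ℤ) : GG p N :=
  diagGL p N fun i => pU p ^ (expo N a i)

/-- The permutation matrix of `σ` (with `permGL σ · e_j = e_{σ j}`, so that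
`permGL` is a group homomorphism). -/
def permGL (σ : Equiv.Perm (Fin N)) : GG p N where
  val := (σ⁻¹).permMatrix ℚ_[p]
  inv := σ.permMatrix ℚ_[p]
  val_inv := by
    show ((σ⁻¹).toPEquiv.toMatrix : Matrix (Fin N) (Fin N) ℚ_[p]) * σ.toPEquiv.toMatrix = 1
    rw [← PEquiv.toMatrix_trans, ← Equiv.toPEquiv_trans]
    simp only [Equiv.self_trans_symm, Equiv.symm_trans_self, Equiv.Perm.inv_def]
    rw [Equiv.toPEquiv_refl, PEquiv.toMatrix_refl]
  inv_val := by
    show (σ.toPEquiv.toMatrix : Matrix (Fin N) (Fin N) ℚ_[p]) * (σ⁻¹).toPEquiv.toMatrix = 1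
    rw [← PEquiv.toMatrix_trans, ← Equiv.toPEquiv_trans]
    simp only [Equiv.self_trans_symm, Equiv.symm_trans_self, Equiv.Perm.inv_def]
    rw [Equiv.toPEquiv_refl, PEquiv.toMatrix_refl]

/-- `ω t_a`. -/
def wS (σ : Equiv.Perm (Fin N)) (a : Fin (N - 1) → ℤ) : GG p N :=
  permGL p N σ * tGL p N a

/-- The permutation `ω₂` (as a matrix: first row block `(0, I_{N-1})`, last row `(1,0,…,0)`). -/
def w2 : Equiv.Perm (Fin N) := (finRotate N)⁻¹

/-- `γ = ω₂ · diag(ϖ, I_{N-1})`. -/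
def gammaGL : GG p N :=
  permGL p N (w2 N) * tGL p N fun i => if (i : ℕ) = 0 then 1 else 0

/-- `S_ω = {a ∈ ℤ^{N-1} : (ω t_a) I (ω t_a)⁻¹ ∩ K ⊆ I}`. -/
def Sset (σ : Equiv.Perm (Fin N)) : Set (Fin (N - 1) → ℤ) :=
  {a | ∀ g ∈ Iset p N,
    wS p N σ a * g * (wS p N σ a)⁻¹ ∈ Kset p N →
    wS p N σ a * g * (wS p N σ a)⁻¹ ∈ Iset p N}

/-- The unit of `k_F^×` attached to a nonzero element of `k_F` (junk value `1` at `0`). -/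
def unitOf (x : ZMod p) : (ZMod p)ˣ :=
  if h : x = 0 then 1 else Units.mk0 x h

/-- The diagonal of the reduction of `m`, as an `N`-tuple of units of `k_F`. -/
def diagOf (m : MM p N) : Fin N → (ZMod p)ˣ :=
  fun i => unitOf p ((redM p N m : Matrix (Fin N) (Fin N) (ZMod p)) i i)

/-- The transformation rule for functions in `H_{IZ}(χ)`, where the character `χ` of `I`
is given by the character `ξ` of the torus `(k_F^×)^N` through the diagonal of the
reduction, extended to `IZ` by `χ(ϖ) = 1`. -/
def HTransf (ξ : (Fin N → (ZMod p)ˣ) →* (kb p)ˣ) (φ : GG p N → kb p) : Prop :=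
  ∀ (n₁ n₂ : ℤ) (m₁ m₂ : MM p N), m₁ ∈ Ipre p N → m₂ ∈ Ipre p N → ∀ g : GG p N,
    φ (piSc p N n₁ * iotaM p N m₁ * g * (piSc p N n₂ * iotaM p N m₂)) =
      (ξ (diagOf p N m₁) : kb p) * (ξ (diagOf p N m₂) : kb p) * φ g

/-- `φ` is supported on the double coset `IZ x I`. -/
def SuppDouble (φ : GG p N → kb p) (x : GG p N) : Prop :=
  ∀ g : GG p N, φ g ≠ 0 → ∃ (n : ℤ) (m₁ m₂ : MM p N), m₁ ∈ Ipre p N ∧ m₂ ∈ Ipre p N ∧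
    g = piSc p N n * iotaM p N m₁ * x * iotaM p N m₂

/-- Membership in `H_{IZ}(χ)`: the transformation rule together with support in
finitely many double cosets `IZ g I`. -/
def HMem (ξ : (Fin N → (ZMod p)ˣ) →* (kb p)ˣ) (φ : GG p N → kb p) : Prop :=
  HTransf p N ξ φ ∧
  ∃ S : Finset (GG p N), ∀ g : GG p N, φ g ≠ 0 →
    ∃ s ∈ S, ∃ (n : ℤ) (m₁ m₂ : MM p N), m₁ ∈ Ipre p N ∧ m₂ ∈ Ipre p N ∧
      g = piSc p N n * iotaM p N m₁ * s * iotaM p N m₂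

section Rep

variable {V : Type} [AddCommGroup V] [Module (kb p) V]

/-- `σ` (here `ρ`) is irreducible. -/
def IsIrred (ρ : Representation (kb p) (Gk p N) V) : Prop :=
  (∃ v : V, v ≠ 0) ∧
  ∀ W : Submodule (kb p) V, (∀ g v, v ∈ W → ρ g v ∈ W) → W = ⊥ ∨ W = ⊤

/-- Membership in the compact induction `ind_{KZ}^G σ`: left `KZ`-equivariance
(where `ϖ` acts trivially), support in finitely many cosets `KZ g`, and smoothness. -/
def IndMem (ρ : Representation (kb p) (Gk p N) V) (f : GG p N → V) : Prop :=
  (∀ (n : ℤ) (m : MM p N) (g : GG p N),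
      f (piSc p N n * iotaM p N m * g) = ρ (redM p N m) (f g)) ∧
  (∃ S : Finset (GG p N), ∀ g : GG p N, f g ≠ 0 →
      ∃ s ∈ S, ∃ (n : ℤ) (m : MM p N), g = piSc p N n * iotaM p N m * s) ∧
  (∃ U : Subgroup (GG p N), IsOpen (U : Set (GG p N)) ∧ ∀ u ∈ U, ∀ g, f (g * u) = f g)

/-- `f` is invariant under right translation by `I_1`. -/
def IsI1Inv (f : GG p N → V) : Prop :=
  ∀ u ∈ I1set p N, ∀ g, f (g * u) = f g

/-- The defining property of the standard function `f_{ω,a}`: an `I_1`-invariant member of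
`ind_{KZ}^G σ` supported on `KZ t_a I_1` with value `v₀` at `ω t_a`. -/
def IsStd (ρ : Representation (kb p) (Gk p N) V) (v₀ : V)
    (σp : Equiv.Perm (Fin N)) (a : Fin (N - 1) → ℤ) (f : GG p N → V) : Prop :=
  IndMem p N ρ f ∧ IsI1Inv p N f ∧
  (∀ g : GG p N, f g ≠ 0 → ∃ (n : ℤ) (m : MM p N) (u : GG p N), u ∈ I1set p N ∧
      g = piSc p N n * iotaM p N m * tGL p N a * u) ∧
  f (wS p N σp a) = v₀

/-- `R` is a set of representatives for `I_1/(I_1 ∩ g⁻¹ I_1 g)`. -/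
def IsRepSet (g : GG p N) (R : Finset (GG p N)) : Prop :=
  (↑R ⊆ I1set p N) ∧
  ∀ x ∈ I1set p N, ∃! r : GG p N, r ∈ R ∧
    (r⁻¹ * x ∈ I1set p N ∧ g * (r⁻¹ * x) * g⁻¹ ∈ I1set p N)

/-- The Hecke operator: `f|T_g = ∑_{r} (r g⁻¹)·f`, where `(h·f)(x) = f(xh)`. -/
def hk (g : GG p N) (R : Finset (GG p N)) (f : GG p N → V) : GG p N → V :=
  fun x => ∑ r ∈ R, f (x * r * g⁻¹)

end Rep


section Matrices

variable {p : ℕ} [Fact p.Prime] {N : ℕ}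

theorem coe_permGL_mul (σ : Equiv.Perm (Fin N)) (g : GG p N) (i j : Fin N) :
    (permGL p N σ * g).1 i j = g.1 (σ⁻¹ i) j := by
  change ((σ⁻¹).permMatrix ℚ_[p] * g.1 : Matrix (Fin N) (Fin N) ℚ_[p]) i j = _
  rw [PEquiv.toMatrix_toPEquiv_mul]
  rfl

theorem coe_mul_permGL (σ : Equiv.Perm (Fin N)) (g : GG p N) (i j : Fin N) :
    (g * permGL p N σ).1 i j = g.1 i (σ j) := by
  change (g.1 * (σ⁻¹).permMatrix ℚ_[p] : Matrix (Fin N) (Fin N) ℚ_[p]) i j = _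
  rw [PEquiv.mul_toMatrix_toPEquiv]
  rfl

theorem coe_diagGL_mul (d : Fin N → ℚ_[p]ˣ) (g : GG p N) (i j : Fin N) :
    (diagGL p N d * g).1 i j = d i * g.1 i j :=
  Matrix.diagonal_mul _ _ _ _

theorem coe_mul_diagGL (d : Fin N → ℚ_[p]ˣ) (g : GG p N) (i j : Fin N) :
    (g * diagGL p N d).1 i j = g.1 i j * d j :=
  Matrix.mul_diagonal _ _ _ _

theorem permGL_mul (σ τ : Equiv.Perm (Fin N)) :
    permGL p N (σ * τ) = permGL p N σ * permGL p N τ :=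
  Units.ext <| by
    change ((σ * τ)⁻¹).permMatrix ℚ_[p] = (σ⁻¹).permMatrix ℚ_[p] * (τ⁻¹).permMatrix ℚ_[p]
    rw [_root_.mul_inv_rev, Matrix.permMatrix_mul]

theorem permGL_inv (σ : Equiv.Perm (Fin N)) : permGL p N σ⁻¹ = (permGL p N σ)⁻¹ :=
  Units.ext rfl

theorem permGL_one : permGL p N 1 = 1 :=
  Units.ext Matrix.permMatrix_one

theorem diagGL_mul (d e : Fin N → ℚ_[p]ˣ) :
    diagGL p N d * diagGL p N e = diagGL p N (d * e) :=
  Units.ext (Matrix.diagonal_mul_diagonal _ _)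

theorem diagGL_inv (d : Fin N → ℚ_[p]ˣ) : (diagGL p N d)⁻¹ = diagGL p N d⁻¹ :=
  Units.ext rfl

theorem permGL_conj_diagGL (σ : Equiv.Perm (Fin N)) (d : Fin N → ℚ_[p]ˣ) :
    permGL p N σ⁻¹ * diagGL p N d * permGL p N σ = diagGL p N (d ∘ σ) := by
  refine Units.ext (Matrix.ext fun i j => ?_)
  rw [coe_mul_permGL, coe_permGL_mul, inv_inv]
  change Matrix.diagonal _ _ _ = Matrix.diagonal _ _ _
  simp [Matrix.diagonal_apply]

theorem piSc_eq_diagGL (k : ℤ) : piSc p N k = diagGL p N fun _ => pU p ^ k :=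
  Units.ext (Matrix.ext fun i j => by
    change algebraMap ℚ_[p] (Matrix (Fin N) (Fin N) ℚ_[p]) _ i j = Matrix.diagonal _ _ _
    rw [Matrix.algebraMap_eq_diagonal]
    rfl)

theorem piSc_mul_comm (k : ℤ) (g : GG p N) : piSc p N k * g = g * piSc p N k := by
  refine Units.ext (Matrix.ext fun i j => ?_)
  rw [piSc_eq_diagGL, coe_diagGL_mul, coe_mul_diagGL, mul_comm]

theorem piSc_add (k l : ℤ) : piSc p N (k + l) = piSc p N k * piSc p N l := by
  rw [piSc_eq_diagGL, piSc_eq_diagGL, piSc_eq_diagGL, diagGL_mul]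
  congr 1
  funext i
  exact _root_.zpow_add _ _ _

theorem piSc_neg (k : ℤ) : piSc p N (-k) = (piSc p N k)⁻¹ := by
  rw [piSc_eq_diagGL, piSc_eq_diagGL, diagGL_inv]
  congr 1
  funext i
  exact _root_.zpow_neg _ _

end Matrices

section Iwahori

variable {p : ℕ} [Fact p.Prime] {N : ℕ}

theorem coe_iotaM (m : MM p N) (i j : Fin N) : (iotaM p N m).1 i j = (m.1 i j : ℚ_[p]) := rfl

theorem coe_redM (m : MM p N) (i j : Fin N) :
    (redM p N m : Matrix (Fin N) (Fin N) (ZMod p)) i j = PadicInt.toZMod (m.1 i j) := rfl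

theorem toZMod_eq_zero_iff (x : ℤ_[p]) : PadicInt.toZMod x = 0 ↔ ‖x‖ < 1 := by
  rw [← RingHom.mem_ker, PadicInt.ker_toZMod, IsLocalRing.mem_maximalIdeal, PadicInt.mem_nonunits]

theorem toZMod_eq_one_iff (x : ℤ_[p]) : PadicInt.toZMod x = 1 ↔ ‖x - 1‖ < 1 := by
  rw [← toZMod_eq_zero_iff, map_sub, map_one, sub_eq_zero]

theorem mem_Kset_iff (g : GG p N) :
    g ∈ Kset p N ↔ (∀ i j, ‖g.1 i j‖ ≤ 1) ∧ ∀ i j, ‖(g⁻¹).1 i j‖ ≤ 1 := by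
  constructor
  · rintro ⟨m, rfl⟩
    refine ⟨fun i j => (m.1 i j).2, fun i j => ?_⟩
    rw [← map_inv]
    exact ((m⁻¹).1 i j).2
  · rintro ⟨h, h'⟩
    have inj : Function.Injective
        (PadicInt.Coe.ringHom.mapMatrix : Matrix (Fin N) (Fin N) ℤ_[p] →+* _) :=
      Matrix.map_injective (f := (PadicInt.Coe.ringHom : ℤ_[p] →+* ℚ_[p])) Subtype.coe_injective
    refine ⟨⟨Matrix.of fun i j => ⟨g.1 i j, h i j⟩, Matrix.of fun i j => ⟨(g⁻¹).1 i j, h' i j⟩,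
      inj ?_, inj ?_⟩, Units.ext (Matrix.ext fun i j => rfl)⟩
    · rw [map_mul, map_one]
      exact g.mul_inv
    · rw [map_mul, map_one]
      exact g.inv_mul

/-- The entries of `g` are integral, and topologically nilpotent below the diagonal. -/
def IwahoriEntries (g : GG p N) : Prop :=
  ∀ i j, ‖g.1 i j‖ ≤ 1 ∧ (j < i → ‖g.1 i j‖ < 1)

theorem iwahoriEntries_iotaM {m : MM p N} (hm : m ∈ Ipre p N) :
    IwahoriEntries (iotaM p N m) := fun i j =>
  ⟨(m.1 i j).2, fun hij => (toZMod_eq_zero_iff _).1 (hm i j hij)⟩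

theorem inv_mem_Ipre {m : MM p N} (hm : m ∈ Ipre p N) : m⁻¹ ∈ Ipre p N := by
  intro i j hij
  rw [map_inv, Matrix.coe_units_inv]
  let _ : Invertible (redM p N m : Matrix (Fin N) (Fin N) (ZMod p)) := (redM p N m).invertible
  exact Matrix.blockTriangular_inv_of_blockTriangular (b := id) (fun i j hij => hm i j hij) hij

theorem mem_Iset_iff (g : GG p N) :
    g ∈ Iset p N ↔ IwahoriEntries g ∧ IwahoriEntries g⁻¹ := by
  constructor
  · rintro ⟨m, hm, rfl⟩
    exact ⟨iwahoriEntries_iotaM hm, by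
      rw [← map_inv]
      exact iwahoriEntries_iotaM (inv_mem_Ipre hm)⟩
  · rintro ⟨h, h'⟩
    obtain ⟨m, rfl⟩ := (mem_Kset_iff g).2 ⟨fun i j => (h i j).1, fun i j => (h' i j).1⟩
    exact ⟨m, fun i j hij => (toZMod_eq_zero_iff _).2 ((h i j).2 hij), rfl⟩

theorem mem_I1set_iff (g : GG p N) :
    g ∈ I1set p N ↔ g ∈ Iset p N ∧ ∀ i, ‖g.1 i i - 1‖ < 1 := by
  constructor
  · rintro ⟨m, ⟨hm, h⟩, rfl⟩
    exact ⟨⟨m, hm, rfl⟩, fun i => (toZMod_eq_one_iff _).1 (h i)⟩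
  · rintro ⟨⟨m, hm, rfl⟩, h⟩
    exact ⟨m, ⟨hm, fun i => (toZMod_eq_one_iff _).2 (h i)⟩, rfl⟩

theorem permGL_mem_Kset (σ : Equiv.Perm (Fin N)) : permGL p N σ ∈ Kset p N := by
  have key : ∀ (τ : Equiv.Perm (Fin N)) (i j), ‖(permGL p N τ).1 i j‖ ≤ 1 := by
    intro τ i j
    rw [← mul_one (permGL p N τ), coe_permGL_mul]
    change ‖(1 : Matrix (Fin N) (Fin N) ℚ_[p]) _ _‖ ≤ 1
    rw [Matrix.one_apply]
    split_ifs <;> simp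
  exact (mem_Kset_iff _).2 ⟨key σ, by rw [← permGL_inv]; exact key σ⁻¹⟩

end Iwahori

section Gamma

variable {p : ℕ} [Fact p.Prime] {n : ℕ}

theorem norm_div_prime_le_one {x : ℚ_[p]} (hx : ‖x‖ < 1) : ‖x * (p : ℚ_[p])⁻¹‖ ≤ 1 := by
  have h := (Padic.norm_le_pow_iff_norm_lt_pow_add_one x (-1)).2 (by simpa using hx)
  have hp : (0 : ℝ) < p := by exact_mod_cast (Fact.out : p.Prime).pos
  rw [norm_mul, norm_inv, Padic.norm_p, inv_inv]
  rw [_root_.zpow_neg_one, ← one_div, le_div_iff₀ hp] at h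
  exact h

theorem norm_mul_prime_lt_one {x : ℚ_[p]} (hx : ‖x‖ ≤ 1) : ‖x * (p : ℚ_[p])‖ < 1 := by
  rw [norm_mul]
  exact mul_lt_one_of_nonneg_of_lt_one_right hx (norm_nonneg _) Padic.norm_p_lt_one

theorem w2_zero : w2 (n + 1) 0 = Fin.last n := by
  rw [w2, Equiv.Perm.inv_eq_iff_eq, finRotate_last]

theorem w2_succ (k : Fin n) : w2 (n + 1) k.succ = k.castSucc := by
  rw [w2, Equiv.Perm.inv_eq_iff_eq, finRotate_apply, Fin.coeSucc_eq_succ]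

theorem w2_inv_last : (w2 (n + 1))⁻¹ (Fin.last n) = 0 := by
  rw [Equiv.Perm.inv_eq_iff_eq, w2_zero]

theorem w2_inv_castSucc (k : Fin n) : (w2 (n + 1))⁻¹ k.castSucc = k.succ := by
  rw [Equiv.Perm.inv_eq_iff_eq, w2_succ]

/-- The diagonal factor of `γ`. -/
def gammaDiag (p : ℕ) [Fact p.Prime] (n : ℕ) : Fin (n + 1) → ℚ_[p]ˣ :=
  Fin.cons (pU p) fun _ => 1

theorem gammaGL_eq :
    gammaGL p (n + 2) = permGL p (n + 2) (w2 (n + 2)) * diagGL p (n + 2) (gammaDiag p (n + 1)) := by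
  rw [gammaGL, tGL]
  congr 2
  funext i
  refine Fin.cases ?_ (fun k => ?_) i
  · simp [expo, gammaDiag]
  · simp [expo, gammaDiag]

theorem coe_gammaGL_conj (g : GG p (n + 2)) (i j : Fin (n + 2)) :
    (gammaGL p (n + 2) * g * (gammaGL p (n + 2))⁻¹).1 i j =
      gammaDiag p (n + 1) ((w2 (n + 2))⁻¹ i) *
        g.1 ((w2 (n + 2))⁻¹ i) ((w2 (n + 2))⁻¹ j) *
        ((gammaDiag p (n + 1) ((w2 (n + 2))⁻¹ j))⁻¹ : ℚ_[p]ˣ) := by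
  rw [gammaGL_eq, _root_.mul_inv_rev, ← permGL_inv, diagGL_inv, ← mul_assoc, coe_mul_permGL,
    coe_mul_diagGL, mul_assoc, coe_permGL_mul, coe_diagGL_mul]
  rfl

theorem coe_gammaGL_inv_conj (g : GG p (n + 2)) (i j : Fin (n + 2)) :
    ((gammaGL p (n + 2))⁻¹ * g * gammaGL p (n + 2)).1 i j =
      ((gammaDiag p (n + 1) i)⁻¹ : ℚ_[p]ˣ) * g.1 (w2 (n + 2) i) (w2 (n + 2) j) *
        gammaDiag p (n + 1) j := by
  rw [gammaGL_eq, _root_.mul_inv_rev, ← permGL_inv, diagGL_inv, ← mul_assoc,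
    coe_mul_diagGL, coe_mul_permGL, mul_assoc, coe_diagGL_mul, coe_permGL_mul, inv_inv]
  rfl

theorem coe_gammaDiag_zero : (gammaDiag p n 0 : ℚ_[p]) = p := rfl

theorem coe_gammaDiag_succ (k : Fin n) : (gammaDiag p n k.succ : ℚ_[p]) = 1 := rfl

theorem IwahoriEntries.gammaGL_conj {g : GG p (n + 2)} (h : IwahoriEntries g) :
    IwahoriEntries (gammaGL p (n + 2) * g * (gammaGL p (n + 2))⁻¹) := by
  intro i j
  rw [coe_gammaGL_conj, Units.val_inv_eq_inv_val]
  refine Fin.lastCases ?_ (fun i => ?_) i <;> refine Fin.lastCases ?_ (fun j => ?_) j <;>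
    simp only [w2_inv_last, w2_inv_castSucc, coe_gammaDiag_zero, coe_gammaDiag_succ,
      inv_one, mul_one, one_mul]
  · have hp : (p : ℚ_[p]) ≠ 0 := (pU p).ne_zero
    rw [mul_right_comm, mul_inv_cancel₀ hp, one_mul]
    exact ⟨(h _ _).1, fun hlt => absurd hlt (lt_irrefl _)⟩
  · have := norm_mul_prime_lt_one (h 0 j.succ).1
    rw [mul_comm] at this
    exact ⟨this.le, fun _ => this⟩
  · exact ⟨norm_div_prime_le_one ((h _ _).2 (Fin.succ_pos i)),
      fun hlt => absurd hlt (Fin.castSucc_lt_last i).not_gt⟩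
  · exact ⟨(h _ _).1, fun hlt => (h _ _).2 (Fin.succ_lt_succ_iff.2 hlt)⟩

theorem IwahoriEntries.gammaGL_inv_conj {g : GG p (n + 2)} (h : IwahoriEntries g) :
    IwahoriEntries ((gammaGL p (n + 2))⁻¹ * g * gammaGL p (n + 2)) := by
  intro i j
  rw [coe_gammaGL_inv_conj, Units.val_inv_eq_inv_val]
  refine Fin.cases ?_ (fun i => ?_) i <;> refine Fin.cases ?_ (fun j => ?_) j <;>
    simp only [w2_zero, w2_succ, coe_gammaDiag_zero, coe_gammaDiag_succ,
      inv_one, mul_one, one_mul]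
  · have hp : (p : ℚ_[p]) ≠ 0 := (pU p).ne_zero
    rw [mul_right_comm, inv_mul_cancel₀ hp, one_mul]
    exact ⟨(h _ _).1, fun hlt => absurd hlt (lt_irrefl _)⟩
  · rw [mul_comm]
    exact ⟨norm_div_prime_le_one ((h _ _).2 (Fin.castSucc_lt_last j)),
      fun hlt => absurd hlt (Fin.succ_pos j).not_gt⟩
  · have := norm_mul_prime_lt_one (h i.castSucc (Fin.last _)).1
    exact ⟨this.le, fun _ => this⟩
  · exact ⟨(h _ _).1, fun hlt => (h _ _).2 (Fin.succ_lt_succ_iff.1 hlt)⟩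

theorem gammaGL_inv_conj_mem_Iset {g : GG p (n + 2)} (hg : g ∈ Iset p (n + 2)) :
    (gammaGL p (n + 2))⁻¹ * g * gammaGL p (n + 2) ∈ Iset p (n + 2) := by
  rw [mem_Iset_iff] at hg ⊢
  refine ⟨hg.1.gammaGL_inv_conj, ?_⟩
  convert hg.2.gammaGL_inv_conj using 1
  group

theorem gammaGL_conj_mem_Iset {g : GG p (n + 2)} (hg : g ∈ Iset p (n + 2)) :
    gammaGL p (n + 2) * g * (gammaGL p (n + 2))⁻¹ ∈ Iset p (n + 2) := by
  rw [mem_Iset_iff] at hg ⊢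
  refine ⟨hg.1.gammaGL_conj, ?_⟩
  convert hg.2.gammaGL_conj using 1
  group

theorem gammaGL_inv_conj_mem_I1set {g : GG p (n + 2)} (hg : g ∈ I1set p (n + 2)) :
    (gammaGL p (n + 2))⁻¹ * g * gammaGL p (n + 2) ∈ I1set p (n + 2) := by
  rw [mem_I1set_iff] at hg ⊢
  refine ⟨gammaGL_inv_conj_mem_Iset hg.1, fun i => ?_⟩
  rw [coe_gammaGL_inv_conj, mul_right_comm, Units.inv_mul, one_mul]
  exact hg.2 _

theorem gammaGL_conj_mem_I1set {g : GG p (n + 2)} (hg : g ∈ I1set p (n + 2)) :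
    gammaGL p (n + 2) * g * (gammaGL p (n + 2))⁻¹ ∈ I1set p (n + 2) := by
  rw [mem_I1set_iff] at hg ⊢
  refine ⟨gammaGL_conj_mem_Iset hg.1, fun i => ?_⟩
  rw [coe_gammaGL_conj, mul_right_comm, Units.mul_inv, one_mul]
  exact hg.2 _

/-- The exponent vector `a^γ`. -/
abbrev gammaExp (a : Fin (n + 2) → ℤ) : Fin (n + 2) → ℤ :=
  fun i => if h : (i : ℕ) + 1 < n + 2 then 1 + a ⟨(i : ℕ) + 1, h⟩ - a 0 else 1 - a 0

theorem expo_gammaExp (a : Fin (n + 2) → ℤ) (i : Fin (n + 3)) :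
    expo (n + 3) (gammaExp a) (w2 (n + 3) i) +
      expo (n + 3) (fun i : Fin (n + 2) => if (i : ℕ) = 0 then 1 else 0) i =
      1 - a 0 + expo (n + 3) a i := by
  refine Fin.cases ?_ (fun k => ?_) i
  · rw [w2_zero]
    simp [expo]
  · rw [w2_succ]
    have hk := k.2
    by_cases h : (k : ℕ) + 1 < n + 2
    · have h' : (k : ℕ) < n + 1 := by lia
      simp [expo, gammaExp, h']
      ring
    · have h' : ¬ (k : ℕ) < n + 1 := by lia
      simp [expo, gammaExp, h']

theorem wS_mul_gammaGL (ω : Equiv.Perm (Fin (n + 3))) (a : Fin (n + 2) → ℤ) :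
    wS p (n + 3) (ω * (w2 (n + 3))⁻¹) (gammaExp a) * gammaGL p (n + 3) =
      piSc p (n + 3) (1 - a 0) * wS p (n + 3) ω a := by
  have key : permGL p (n + 3) (w2 (n + 3))⁻¹ * tGL p (n + 3) (gammaExp a) *
      gammaGL p (n + 3) = piSc p (n + 3) (1 - a 0) * tGL p (n + 3) a := by
    rw [gammaGL, ← mul_assoc, tGL, permGL_conj_diagGL, piSc_eq_diagGL, tGL, tGL, diagGL_mul,
      diagGL_mul]
    congr 1
    funext i
    simp only [Pi.mul_apply, Function.comp_apply, ← _root_.zpow_add]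
    exact congrArg (pU p ^ ·) (expo_gammaExp a i)
  rw [wS, wS, permGL_mul, ← mul_assoc, piSc_mul_comm,
    mul_assoc (permGL p (n + 3) ω) (piSc _ _ _), ← key]
  simp only [mul_assoc]

theorem gammaExp_mem_Sset {ω : Equiv.Perm (Fin (n + 3))} {a : Fin (n + 2) → ℤ}
    (ha : a ∈ Sset p (n + 3) ω) :
    gammaExp a ∈ Sset p (n + 3) (ω * (w2 (n + 3))⁻¹) := by
  intro g hg
  have h : wS p (n + 3) (ω * (w2 (n + 3))⁻¹) (gammaExp a) * g *
      (wS p (n + 3) (ω * (w2 (n + 3))⁻¹) (gammaExp a))⁻¹ =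
      wS p (n + 3) ω a * ((gammaGL p (n + 3))⁻¹ * g * gammaGL p (n + 3)) *
        (wS p (n + 3) ω a)⁻¹ := by
    rw [eq_mul_inv_of_mul_eq (wS_mul_gammaGL ω a)]
    refine Eq.trans ?_ (mul_inv_cancel_right _ (piSc p (n + 3) (1 - a 0)))
    rw [← piSc_mul_comm]
    group
  rw [h]
  exact ha _ (gammaGL_inv_conj_mem_Iset hg)

variable {V : Type} [AddCommGroup V] [Module (kb p) V] {ρ : Representation (kb p) (Gk p (n + 3)) V}

theorem IndMem.smul {f : GG p (n + 3) → V} (hf : IndMem p (n + 3) ρ f)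
    (h : GG p (n + 3)) :
    IndMem p (n + 3) ρ fun x => f (x * h) := by
  classical
  obtain ⟨hequiv, ⟨S, hS⟩, U, hU, hUf⟩ := hf
  refine ⟨fun k m g => (congrArg f (mul_assoc _ g h)).trans (hequiv k m (g * h)), ⟨S.image (· * h⁻¹), fun g hg => ?_⟩,
    U.comap (MulAut.conj h⁻¹).toMonoidHom, ?_, fun u hu g => ?_⟩
  · obtain ⟨s, hs, k, m, hsg⟩ := hS _ hg
    exact ⟨s * h⁻¹, Finset.mem_image_of_mem _ hs, k, m, by
      rw [← mul_assoc, ← hsg, mul_inv_cancel_right]⟩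
  · refine hU.preimage (f := fun x => h⁻¹ * x * h⁻¹⁻¹) (by fun_prop)
  · refine Eq.trans (congrArg f ?_) (hUf _ hu (g * h))
    simp [mul_assoc]

theorem IsStd.gammaGL_smul {v₀ : V} {ω : Equiv.Perm (Fin (n + 3))} {a : Fin (n + 2) → ℤ}
    {f : GG p (n + 3) → V} (hf : IsStd p (n + 3) ρ v₀ ω a f) :
    IsStd p (n + 3) ρ v₀ (ω * (w2 (n + 3))⁻¹) (gammaExp a)
      fun x => f (x * gammaGL p (n + 3)) := by
  obtain ⟨hind, hinv, hsupp, hval⟩ := hf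
  refine ⟨hind.smul _, fun u hu g => ?_, fun g hg => ?_, ?_⟩
  · refine Eq.trans (congrArg f ?_)
      (hinv _ (gammaGL_inv_conj_mem_I1set hu) (g * gammaGL p (n + 3)))
    group
  · obtain ⟨k, m, u, hu, hgu⟩ := hsupp _ hg
    obtain ⟨w, hw⟩ := permGL_mem_Kset (p := p) (w2 (n + 3))⁻¹
    refine ⟨k - (1 - a 0), m * w, _, gammaGL_conj_mem_I1set hu, ?_⟩
    have ht := wS_mul_gammaGL (p := p) 1 a
    rw [wS, wS, one_mul, permGL_one, one_mul] at ht
    have hc := piSc_mul_comm (1 - a 0) (iotaM p (n + 3) m)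
    rw [eq_mul_inv_of_mul_eq hgu, map_mul, hw, sub_eq_add_neg, piSc_add, piSc_neg]
    generalize piSc p (n + 3) (1 - a 0) = z at ht hc ⊢
    calc
      _ = piSc p (n + 3) k * z⁻¹ * (z * iotaM p (n + 3) m) * tGL p (n + 3) a * u *
          (gammaGL p (n + 3))⁻¹ := by group
      _ = piSc p (n + 3) k * z⁻¹ * iotaM p (n + 3) m * (z * tGL p (n + 3) a) * u *
          (gammaGL p (n + 3))⁻¹ := by rw [hc]; group
      _ = _ := by rw [← ht]; group
  · change f (_ * _) = v₀
    rw [wS_mul_gammaGL, ← mul_one (piSc p (n + 3) _), ← map_one (iotaM p (n + 3)), hind.1, hval]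
    simp

end Gamma

/-- `a^γ ∈ S_{ω ω₂⁻¹}` and `γ·f_{ω,a} = f_{ω ω₂⁻¹, a^γ}`. -/
theorem stmt10 (p : ℕ) [Fact p.Prime] (n : ℕ)
    {V : Type} [AddCommGroup V] [Module (kb p) V] [FiniteDimensional (kb p) V]
    (ρ : Representation (kb p) (Gk p (n + 3)) V) (hirr : IsIrred p (n + 3) ρ)
    (v₀ : V) (hv₀ : v₀ ≠ 0)
    (hfix : ∀ m ∈ I1pre p (n + 3), ρ (redM p (n + 3) m) v₀ = v₀)
    (ω : Equiv.Perm (Fin (n + 3))) (a : Fin (n + 2) → ℤ) (ha : a ∈ Sset p (n + 3) ω) :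
    (fun i : Fin (n + 2) =>
        if h : (i : ℕ) + 1 < n + 2 then 1 + a ⟨(i : ℕ) + 1, h⟩ - a 0 else 1 - a 0) ∈
      Sset p (n + 3) (ω * (w2 (n + 3))⁻¹) ∧
    ∀ f : GG p (n + 3) → V, IsStd p (n + 3) ρ v₀ ω a f →
      IsStd p (n + 3) ρ v₀ (ω * (w2 (n + 3))⁻¹)
        (fun i : Fin (n + 2) =>
          if h : (i : ℕ) + 1 < n + 2 then 1 + a ⟨(i : ℕ) + 1, h⟩ - a 0 else 1 - a 0)
        (fun x => f (x * gammaGL p (n + 3))) := by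
  exact ⟨gammaExp_mem_Sset ha, fun f hf => hf.gammaGL_smul⟩

end IH
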